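/- Every graph G with maximum degree Δ(G) < k has an equitable k-coloring. -/

import Mathlib

namespace HajnalSzemeredi

open Finset

section

open scoped Classical

variable {V κ : Type*}

/-! ### Simple directed paths inside a finite set -/

/-- `PathIn R a X x`: there is a directed `R`-path without repeated vertices from `x` to `a`
all of whose vertices lie in `X`. -/
inductive PathIn (R : κ → κ → Prop) (a : κ) : Finset κ → κ → Prop
  | refl {X : Finset κ} : a ∈ X → PathIn R a X a
  | step {X : Finset κ} {x c : κ} :
      x ∈ X → R x c → PathIn R a (X.erase x) c → PathIn R a X x

namespace PathIn

variable {R R' : κ → κ → Prop} {a x y c : κ} {X Y : Finset κ}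

lemma left_mem (h : PathIn R a X x) : x ∈ X := by
  cases h <;> assumption

lemma right_mem (h : PathIn R a X x) : a ∈ X := by
  induction h with
  | refl h => exact h
  | step _ _ _ ih => exact mem_of_mem_erase ih

lemma mono_rel (h : PathIn R a X x) (hR : ∀ p ∈ X, ∀ q ∈ X, R p q → R' p q) :
    PathIn R' a X x := by
  induction h with
  | refl h => exact .refl h
  | step hx hxc hc ih =>
    exact .step hx (hR _ hx _ (mem_of_mem_erase hc.left_mem) hxc)
      (ih fun p hp q hq => hR p (mem_of_mem_erase hp) q (mem_of_mem_erase hq))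

/-- The arcs into the starting vertex are irrelevant. -/
lemma mono_rel_of_ne (h : PathIn R a X x)
    (hR : ∀ p ∈ X, ∀ q ∈ X, q ≠ x → R p q → R' p q) : PathIn R' a X x := by
  cases h with
  | refl h => exact .refl h
  | step hx hxc hc =>
    exact .step hx (hR _ hx _ (mem_of_mem_erase hc.left_mem) (ne_of_mem_erase hc.left_mem) hxc)
      (hc.mono_rel fun p hp q hq =>
        hR p (mem_of_mem_erase hp) q (mem_of_mem_erase hq) (ne_of_mem_erase hq))

lemma mono_set (h : PathIn R a X x) (hXY : X ⊆ Y) : PathIn R a Y x := by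
  induction h generalizing Y with
  | refl h => exact .refl (hXY h)
  | step hx hxc _ ih => exact .step (hXY hx) hxc (ih (erase_subset_erase _ hXY))

/-- Either a path avoids `y`, or its final segment is a path from `y`. -/
lemma erase_or (h : PathIn R a X x) (y : κ) : PathIn R a (X.erase y) x ∨ PathIn R a X y := by
  induction h with
  | @refl X h =>
    by_cases hy : y = a
    · subst hy
      exact .inr (.refl h)
    · exact .inl (.refl (mem_erase.2 ⟨Ne.symm hy, h⟩))
  | @step X x c hx hxc hc ih =>
    by_cases hy : y = x
    · subst hy
      exact .inr (.step hx hxc hc)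
    · rcases ih with ih | ih
      · exact .inl (.step (mem_erase.2 ⟨Ne.symm hy, hx⟩) hxc (erase_right_comm (s := X) ▸ ih))
      · exact .inr (ih.mono_set (erase_subset _ _))

lemma cons (h : PathIn R a X c) (hx : x ∈ X) (hxc : R x c) : PathIn R a X x :=
  (h.erase_or x).elim (.step hx hxc) id

lemma restrict (h : PathIn R a X x) (hY : ∀ y, PathIn R a X y → y ∈ Y) : PathIn R a Y x := by
  induction h generalizing Y with
  | refl h => exact .refl (hY _ (.refl h))
  | @step X x c hx hxc hc ih =>
    refine .step (hY _ (.step hx hxc hc)) hxc (ih fun y hy => mem_erase.2 ⟨?_, ?_⟩)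
    · exact ne_of_mem_erase hy.left_mem
    · exact hY y (hy.mono_set (erase_subset _ _))

end PathIn

/-- If every vertex of `X` has a path to `a`, then there is a nonempty set `T` of vertices, each of
which can be deleted without destroying the accessibility of the others, such that arcs leaving `T`
inside `X` all end in a single vertex `U`. -/
lemma exists_terminal_set {R : κ → κ → Prop} {a : κ} {X : Finset κ}
    (hX : ∀ x ∈ X, PathIn R a X x) (ha : a ∈ X) (hcard : 1 < #X) :
    ∃ U ∈ X, ∃ T ⊆ X, U ∉ T ∧ T.Nonempty ∧
      (∀ W ∈ T, ∀ x ∈ X.erase W, PathIn R a (X.erase W) x) ∧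
      ∀ x ∈ T, ∀ c ∈ X, c ∉ T → c ≠ U → ¬ R x c := by
  let T : κ → Finset κ := fun U => {x ∈ X.erase U | ¬ PathIn R a (X.erase U) x}
  have hTa : (T a).Nonempty := by
    obtain ⟨x, hx, hxa⟩ := exists_mem_ne hcard a
    exact ⟨x, mem_filter.2 ⟨mem_erase.2 ⟨hxa, hx⟩, fun h => notMem_erase a X h.right_mem⟩⟩
  obtain ⟨U, hU, hmin⟩ := exists_min_image {U ∈ X | (T U).Nonempty} (fun U => #(T U))
    ⟨a, mem_filter.2 ⟨ha, hTa⟩⟩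
  obtain ⟨hUX, hUT⟩ := mem_filter.1 hU
  refine ⟨U, hUX, T U, fun x hx => mem_of_mem_erase (mem_filter.1 hx).1,
    fun h => notMem_erase U X (mem_filter.1 h).1, hUT, ?_, ?_⟩
  · intro W hW x hx
    by_contra hcon
    obtain ⟨hWU, hWX⟩ := mem_erase.1 (mem_filter.1 hW).1
    have avoid : ∀ c, PathIn R a (X.erase U) c → PathIn R a ((X.erase U).erase W) c :=
      fun c hc => (hc.erase_or W).resolve_right (mem_filter.1 hW).2
    have hlt : #(T W) < #(T U) := by
      refine card_lt_card ⟨fun v hv => ?_, fun h => notMem_erase W X (mem_filter.1 (h hW)).1⟩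
      obtain ⟨hvW, hv⟩ := mem_filter.1 hv
      have hvX := mem_of_mem_erase hvW
      refine mem_filter.2 ⟨mem_erase.2 ⟨?_, hvX⟩, fun h => hv ?_⟩
      · rintro rfl
        apply hv
        cases hX v hvX with
        | refl h => exact .refl hvW
        | step _ hxc hc => exact .step hvW hxc (erase_right_comm (s := X) ▸ avoid _ hc)
      · exact (avoid v h).mono_set (erase_subset_erase _ (erase_subset _ _))
    exact absurd (hmin W (mem_filter.2 ⟨hWX, x, mem_filter.2 ⟨hx, hcon⟩⟩)) (not_le.2 hlt)
  · intro x hx c hc hcT hcU hxc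
    obtain ⟨hxU, hx⟩ := mem_filter.1 hx
    have hcU' := mem_erase.2 ⟨hcU, hc⟩
    have : PathIn R a (X.erase U) c := by
      by_contra h
      exact hcT (mem_filter.2 ⟨hcU', h⟩)
    exact hx (this.cons hxU hxc)

/-! ### Colorings of vertex sets and their classes -/

/-- `f` properly colors the subgraph of `G` induced by `S`, with colors in `C`. -/
structure IsCol (G : SimpleGraph V) (S : Finset V) (C : Finset κ) (f : V → κ) : Prop where
  mem : ∀ v ∈ S, f v ∈ C
  proper : ∀ u ∈ S, ∀ v ∈ S, G.Adj u v → f u ≠ f v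

/-- The class of color `c` in `S`. -/
noncomputable abbrev cls (S : Finset V) (f : V → κ) (c : κ) : Finset V := {v ∈ S | f v = c}

/-- The neighbors of `v` in `S`. -/
noncomputable abbrev nbr (G : SimpleGraph V) (S : Finset V) (v : V) : Finset V := {w ∈ S | G.Adj v w}

/-- No neighbor of `v` in `S` has color `c`. -/
def Free (G : SimpleGraph V) (S : Finset V) (f : V → κ) (v : V) (c : κ) : Prop :=
  ∀ w ∈ S, f w = c → ¬ G.Adj v w

/-- Some vertex of color `x` can be recolored with `c`. -/
def Movable (G : SimpleGraph V) (S : Finset V) (f : V → κ) (x c : κ) : Prop :=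
  ∃ v ∈ S, f v = x ∧ Free G S f v c

variable {G : SimpleGraph V} {S S' : Finset V} {C C' : Finset κ} {f g : V → κ} {v : V} {a b c : κ}
  {s : ℕ}

lemma IsCol.subset (h : IsCol G S C f) (hS : S' ⊆ S) : IsCol G S' C f :=
  ⟨fun v hv => h.mem v (hS hv), fun u hu v hv => h.proper u (hS hu) v (hS hv)⟩

lemma IsCol.insert (h : IsCol G S C f) (hc : c ∈ C) (hv : v ∉ S) (hfree : Free G S f v c) :
    IsCol G (insert v S) C (Function.update f v c) := by
  have hne : ∀ w ∈ S, w ≠ v := fun w hw hwv => hv (hwv ▸ hw)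
  constructor
  · intro w hw
    rcases mem_insert.1 hw with rfl | hw
    · simpa using hc
    · simpa [Function.update_of_ne (hne w hw)] using h.mem w hw
  · intro u hu w hw huw
    rcases mem_insert.1 hu with hu | hu <;> rcases mem_insert.1 hw with hw | hw
    · exact absurd (hu.trans hw.symm) huw.ne
    · rw [hu] at huw ⊢
      rw [Function.update_self, Function.update_of_ne (hne w hw)]
      exact fun h' => hfree w hw h'.symm huw
    · rw [hw] at huw ⊢
      rw [Function.update_self, Function.update_of_ne (hne u hu)]
      exact fun h' => hfree u hu h' huw.symm
    · rw [Function.update_of_ne (hne w hw), Function.update_of_ne (hne u hu)]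
      exact h.proper u hu w hw huw

lemma IsCol.update (h : IsCol G S C f) (hc : c ∈ C) (hv : v ∈ S) (hfree : Free G S f v c) :
    IsCol G S C (Function.update f v c) := by
  have := (h.subset (erase_subset v S)).insert hc (notMem_erase v S)
    fun w hw => hfree w (mem_of_mem_erase hw)
  rwa [insert_erase hv] at this

lemma IsCol.union (hf : IsCol G S C f) (hg : IsCol G S' C' g) (hC : Disjoint C C')
    (hS : Disjoint S S') :
    ∃ h : V → κ, IsCol G (S ∪ S') (C ∪ C') h ∧ (∀ v ∈ S, h v = f v) ∧ (∀ v ∈ S', h v = g v) ∧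
      (∀ c ∈ C, cls (S ∪ S') h c = cls S f c) ∧ ∀ c ∈ C', cls (S ∪ S') h c = cls S' g c := by
  let h : V → κ := fun v => if v ∈ S then f v else g v
  have h1 : ∀ v ∈ S, h v = f v := fun v hv => if_pos hv
  have h2 : ∀ v ∈ S', h v = g v := fun v hv => if_neg fun h => Finset.disjoint_left.1 hS h hv
  have hd : ∀ c ∈ C, c ∉ C' := fun c hc => Finset.disjoint_left.1 hC hc
  refine ⟨h, ⟨?_, ?_⟩, h1, h2, ?_, ?_⟩
  · intro v hv
    rcases mem_union.1 hv with hv | hv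
    · exact mem_union_left _ (h1 v hv ▸ hf.mem v hv)
    · exact mem_union_right _ (h2 v hv ▸ hg.mem v hv)
  · intro u hu v hv huv
    rcases mem_union.1 hu with hu | hu <;> rcases mem_union.1 hv with hv | hv
    · rw [h1 u hu, h1 v hv]; exact hf.proper u hu v hv huv
    · rw [h1 u hu, h2 v hv]
      exact fun e => hd _ (hf.mem u hu) (e ▸ hg.mem v hv)
    · rw [h2 u hu, h1 v hv]
      exact fun e => hd _ (hf.mem v hv) (e ▸ hg.mem u hu)
    · rw [h2 u hu, h2 v hv]; exact hg.proper u hu v hv huv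
  · intro c hc
    ext v
    simp only [cls, mem_filter, mem_union]
    constructor
    · rintro ⟨hv | hv, e⟩
      · exact ⟨hv, h1 v hv ▸ e⟩
      · exact absurd (hg.mem v hv) (hd _ (h2 v hv ▸ e ▸ hc))
    · rintro ⟨hv, e⟩
      exact ⟨.inl hv, (h1 v hv).trans e⟩
  · intro c hc
    ext v
    simp only [cls, mem_filter, mem_union]
    constructor
    · rintro ⟨hv | hv, e⟩
      · exact absurd (h1 v hv ▸ e ▸ hc) (hd _ (hf.mem v hv))
      · exact ⟨hv, h2 v hv ▸ e⟩
    · rintro ⟨hv, e⟩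
      exact ⟨.inr hv, (h2 v hv).trans e⟩

lemma card_cls_insert (hv : v ∉ S) (f : V → κ) (b c : κ) :
    #(cls (insert v S) (Function.update f v b) c) = #(cls S f c) + if b = c then 1 else 0 := by
  have : cls S (Function.update f v b) c = cls S f c :=
    filter_congr fun w hw => by
      rw [Function.update_of_ne (ne_of_mem_of_not_mem hw hv)]
  unfold cls at this ⊢
  rw [filter_insert, Function.update_self, this]
  split_ifs
  · exact card_insert_of_notMem fun h => hv (mem_filter.1 h).1
  · rfl

lemma card_cls_erase (hv : v ∈ S) (f : V → κ) (c : κ) :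
    #(cls (S.erase v) f c) + (if f v = c then 1 else 0) = #(cls S f c) := by
  have := card_cls_insert (notMem_erase v S) f (f v) c
  rwa [Function.update_eq_self, insert_erase hv, eq_comm] at this

lemma card_cls_update (hv : v ∈ S) (f : V → κ) (b c : κ) :
    #(cls S (Function.update f v b) c) + (if f v = c then 1 else 0) =
      #(cls S f c) + if b = c then 1 else 0 := by
  have h1 := card_cls_insert (notMem_erase v S) f b c
  have h2 := card_cls_erase hv f c
  rw [insert_erase hv] at h1
  omega

/-- Shifting one vertex along each arc of a path from `x` to `a` moves one unit of size from the
class `x` to the class `a`. -/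
lemma exists_shift {X : Finset κ} {x : κ} (hX : X ⊆ C)
    (hpath : PathIn (Movable G S f) a X x) (hf : IsCol G S C f) :
    ∃ g : V → κ, IsCol G S C g ∧ ∀ c, #(cls S g c) + (if x = c then 1 else 0) =
      #(cls S f c) + if a = c then 1 else 0 := by
  induction hk : #X generalizing X x f with
  | zero => exact absurd (card_pos.2 ⟨x, hpath.left_mem⟩) (by omega)
  | succ n ih =>
    cases hpath with
    | refl h => exact ⟨f, hf, fun c => rfl⟩
    | @step _ _ d hx hxd hd =>
      obtain ⟨v, hv, rfl, hfree⟩ := hxd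
      have hdX := mem_of_mem_erase hd.left_mem
      have hpath' : PathIn (Movable G S (Function.update f v d)) a (X.erase (f v)) d := by
        refine hd.mono_rel_of_ne ?_
        rintro p hp q hq hqd ⟨w, hw, rfl, hwq⟩
        refine ⟨w, hw, Function.update_of_ne ?_ _ _, fun u hu huq => hwq u hu ?_⟩
        · rintro rfl; exact ne_of_mem_erase hp rfl
        · rwa [Function.update_of_ne] at huq
          rintro rfl
          exact hqd (by simpa using huq.symm)
      obtain ⟨g, hg, hcard⟩ := ih ((erase_subset _ _).trans hX) hpath'
        (hf.update (hX hdX) hv hfree) (by rw [card_erase_of_mem hx, hk]; rfl)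
      refine ⟨g, hg, fun c => ?_⟩
      have h1 := hcard c
      have h2 := card_cls_update hv f d c
      omega

/-! ### Counting neighbors -/

lemma sum_card_nbr_comm (G : SimpleGraph V) (S S' : Finset V) :
    ∑ v ∈ S, #(nbr G S' v) = ∑ w ∈ S', #(nbr G S w) := by
  have := sum_card_bipartiteAbove_eq_sum_card_bipartiteBelow (s := S) (t := S') G.Adj
  simpa only [bipartiteAbove, bipartiteBelow, nbr, G.adj_comm] using this

lemma sum_card_nbr_cls (G : SimpleGraph V) (S : Finset V) (f : V → κ) (X : Finset κ) (v : V) :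
    ∑ c ∈ X, #(nbr G (cls S f c) v) = #(nbr G {w ∈ S | f w ∈ X} v) := by
  rw [card_eq_sum_card_fiberwise (f := f) (t := X)]
  · refine sum_congr rfl fun c hc => congrArg card ?_
    ext w
    simp only [mem_filter]
    constructor
    · rintro ⟨⟨h1, rfl⟩, h2⟩; exact ⟨⟨⟨h1, hc⟩, h2⟩, rfl⟩
    · rintro ⟨⟨⟨h1, _⟩, h2⟩, rfl⟩; exact ⟨⟨h1, rfl⟩, h2⟩
  · intro w hw
    exact (mem_filter.1 (mem_filter.1 (mem_coe.1 hw)).1).2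

lemma card_nbr_add_sum (G : SimpleGraph V) (S : Finset V) (f : V → κ) (X : Finset κ) (v : V) :
    #(nbr G {w ∈ S | f w ∉ X} v) + ∑ c ∈ X, #(nbr G (cls S f c) v) = #(nbr G S v) := by
  rw [sum_card_nbr_cls, add_comm, ← card_filter_add_card_filter_not (s := nbr G S v) (f · ∈ X)]
  simp only [nbr, filter_filter, and_comm]

lemma card_nbr_cls_pos (h : ¬ Free G S f v c) : 0 < #(nbr G (cls S f c) v) := by
  simp only [Free, not_forall, not_not] at h
  obtain ⟨w, hw, hwc, hvw⟩ := h
  exact card_pos.2 ⟨w, mem_filter.2 ⟨mem_filter.2 ⟨hw, hwc⟩, hvw⟩⟩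

lemma card_nbr_add_card_le {X D : Finset κ} (hD : D ⊆ X) (h : ∀ c ∈ D, ¬ Free G S f v c) :
    #(nbr G {w ∈ S | f w ∉ X} v) + #D ≤ #(nbr G S v) := by
  rw [← card_nbr_add_sum G S f X v, card_eq_sum_ones D]
  gcongr
  exact (sum_le_sum fun c hc => Nat.succ_le_of_lt (card_nbr_cls_pos (h c hc))).trans
    (sum_le_sum_of_subset hD)

lemma exists_free (h : #(nbr G S v) < #C) : ∃ c ∈ C, Free G S f v c := by
  by_contra! hcon
  have := card_nbr_add_card_le Subset.rfl hcon
  omega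

/-! ### Solo edges -/

/-- `z` is the only neighbor of `y` in the color class of `z`. -/
def Solo (G : SimpleGraph V) (S : Finset V) (f : V → κ) (z y : V) : Prop :=
  G.Adj y z ∧ ∀ w ∈ S, f w = f z → G.Adj y w → w = z

lemma exists_solo_of_card_nbr_cls {y : V} (h : #(nbr G (cls S f c) y) = 1) :
    ∃ z ∈ S, f z = c ∧ Solo G S f z y := by
  obtain ⟨z, hz⟩ := card_eq_one.1 h
  have hmem : ∀ w, w ∈ nbr G (cls S f c) y ↔ w = z := fun w => by rw [hz, mem_singleton]
  simp only [nbr, cls, mem_filter] at hmem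
  obtain ⟨⟨hzS, rfl⟩, hyz⟩ := (hmem z).2 rfl
  exact ⟨z, hzS, rfl, hyz, fun w hw hwz hyw => (hmem w).1 ⟨⟨hw, hwz⟩, hyw⟩⟩

section Counting

variable {X T : Finset κ} {q : ℕ}

/-- A vertex `y` with a neighbor in every class of `X` has many solo neighbors in the
classes of `T`. -/
lemma card_add_card_nbr_lt (hq : #C = #X + q) (hTX : T ⊆ X) {y : V}
    (hdeg : #(nbr G S y) < #C) (hy : ∀ c ∈ X, ¬ Free G S f y c) :
    #T + #(nbr G {w ∈ S | f w ∉ X} y) < q + #{z ∈ S | f z ∈ T ∧ Solo G S f z y} := by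
  have hsum := card_nbr_add_sum G S f X y
  have hge : #X + #{c ∈ T | #(nbr G (cls S f c) y) ≠ 1} ≤ ∑ c ∈ X, #(nbr G (cls S f c) y) := by
    have hT : #{c ∈ T | #(nbr G (cls S f c) y) ≠ 1} ≤ #{c ∈ X | #(nbr G (cls S f c) y) ≠ 1} :=
      card_le_card (filter_subset_filter _ hTX)
    calc _ ≤ #X + #{c ∈ X | #(nbr G (cls S f c) y) ≠ 1} := by gcongr
      _ = ∑ c ∈ X, (1 + if #(nbr G (cls S f c) y) ≠ 1 then 1 else 0) := by
        rw [sum_add_distrib, card_filter, card_eq_sum_ones X]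
      _ ≤ _ := sum_le_sum fun c hc => by
        have := card_nbr_cls_pos (hy c hc)
        split_ifs <;> omega
  have hsplit := card_filter_add_card_filter_not (s := T) (fun c => #(nbr G (cls S f c) y) = 1)
  have hsolo : #{c ∈ T | #(nbr G (cls S f c) y) = 1} ≤ #{z ∈ S | f z ∈ T ∧ Solo G S f z y} := by
    refine (card_le_card ?_).trans (card_image_le (f := f))
    intro c hc
    obtain ⟨hcT, hc⟩ := mem_filter.1 hc
    obtain ⟨z, hz, rfl, hzy⟩ := exists_solo_of_card_nbr_cls hc
    exact mem_image_of_mem f (mem_filter.2 ⟨hz, hcT, hzy⟩)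
  simp only [ne_eq] at hge
  omega

/-- If no solo vertex of the class `W` can be moved within `X`, then `T` is large. -/
lemma lt_card_of_not_movable {W : κ} (hW : W ∈ X)
    (hcard : #(cls S f W) = s) (hB : #{v ∈ S | f v ∉ X} = q * s + 1)
    (hBX : ∀ y ∈ S, f y ∉ X → ∀ c ∈ X, ¬ Free G S f y c)
    (hWT : ∀ x ∈ cls S f W, #(nbr G {v ∈ S | f v ∉ X} x) ≤ q + #T)
    (hsolo : ∀ z ∈ cls S f W, ∀ y ∈ S, f y ∉ X → Solo G S f z y →
      #(nbr G {v ∈ S | f v ∉ X} z) ≤ q) :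
    q < #T := by
  set B : Finset V := {v ∈ S | f v ∉ X} with hBdef
  let Z : Finset V := {z ∈ cls S f W | ∃ y ∈ B, Solo G S f z y}
  let D : Finset V := {z ∈ cls S f W | ¬ ∃ y ∈ B, Solo G S f z y}
  let N : Finset V := {y ∈ B | ∃ z ∈ Z, G.Adj z y}
  have hZD : #Z + #D = s := by
    rw [← hcard]; exact card_filter_add_card_filter_not _
  have hN : #N ≤ q * #Z := by
    have : N ⊆ Z.biUnion (nbr G B) := by
      intro y hy
      obtain ⟨hyB, z, hz, hzy⟩ := mem_filter.1 hy
      exact mem_biUnion.2 ⟨z, hz, mem_filter.2 ⟨hyB, hzy⟩⟩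
    rw [mul_comm]
    refine (card_le_card this).trans (card_biUnion_le_card_mul _ _ _ fun z hz => ?_)
    obtain ⟨hzW, y, hy, hzy⟩ := mem_filter.1 hz
    exact hsolo z hzW y (mem_filter.1 hy).1 (mem_filter.1 hy).2 hzy
  have hNc : 2 * #(B \ N) ≤ (q + #T) * #D := by
    calc 2 * #(B \ N) = ∑ y ∈ B \ N, 2 := by rw [sum_const, smul_eq_mul, mul_comm]
      _ ≤ ∑ y ∈ B \ N, #(nbr G D y) := sum_le_sum fun y hy => ?_
      _ ≤ ∑ y ∈ B, #(nbr G D y) := sum_le_sum_of_subset sdiff_subset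
      _ = ∑ x ∈ D, #(nbr G B x) := sum_card_nbr_comm G B D
      _ ≤ ∑ x ∈ D, (q + #T) := sum_le_sum fun x hx => hWT x (mem_filter.1 hx).1
      _ = (q + #T) * #D := by rw [sum_const, smul_eq_mul, mul_comm]
    obtain ⟨hyB, hyN⟩ := mem_sdiff.1 hy
    have hyS := (mem_filter.1 hyB).1
    have hpos := card_nbr_cls_pos (hBX y hyS (mem_filter.1 hyB).2 W hW)
    have hne : #(nbr G (cls S f W) y) ≠ 1 := by
      intro h
      obtain ⟨z, hz, rfl, hzy⟩ := exists_solo_of_card_nbr_cls h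
      exact hyN (mem_filter.2 ⟨hyB, z, mem_filter.2 ⟨mem_filter.2 ⟨hz, rfl⟩, y, hyB, hzy⟩,
        hzy.1.symm⟩)
    have hsub : nbr G (cls S f W) y ⊆ nbr G D y := by
      intro z hz
      obtain ⟨hzW, hyz⟩ := mem_filter.1 hz
      refine mem_filter.2 ⟨mem_filter.2 ⟨hzW, fun h => hyN ?_⟩, hyz⟩
      exact mem_filter.2 ⟨hyB, z, mem_filter.2 ⟨hzW, h⟩, hyz.symm⟩
    have := card_le_card hsub
    omega
  have hBN : #(B \ N) + #N = #B := card_sdiff_add_card_eq_card (filter_subset _ _)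
  by_contra! hlt
  have h1 : (q + #T) * #D ≤ 2 * q * #D := by
    gcongr
    omega
  subst hZD
  nlinarith

/-- Among the solo vertices in the classes of `T`, either one can be moved to another class of `X`,
or one has two nonadjacent solo neighbors. -/
lemma exists_solo (hdeg : ∀ v ∈ S, #(nbr G S v) < #C) (hq : #C = #X + q) (hTX : T ⊆ X)
    (hT : T.Nonempty) {U : κ} (hU : U ∈ X) (hUT : U ∉ T) (hcard : ∀ c ∈ T, #(cls S f c) = s)
    (hB : #{v ∈ S | f v ∉ X} = q * s + 1)
    (hBX : ∀ y ∈ S, f y ∉ X → ∀ c ∈ X, ¬ Free G S f y c)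
    (hTU : ∀ x ∈ S, f x ∈ T → ∀ c ∈ X, c ∉ T → c ≠ U → ¬ Free G S f x c) :
    ∃ z ∈ S, f z ∈ T ∧ ∃ y ∈ S, f y ∉ X ∧ Solo G S f z y ∧
      ((∃ c ∈ X, c ≠ f z ∧ Free G S f z c) ∨
        ∃ y' ∈ S, f y' ∉ X ∧ Solo G S f z y' ∧ y' ≠ y ∧ ¬ G.Adj y y') := by
  by_contra! hcon
  set B : Finset V := {v ∈ S | f v ∉ X} with hBdef
  have hmemB : ∀ {v}, v ∈ B ↔ v ∈ S ∧ f v ∉ X := mem_filter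
  have hsolo : ∀ z ∈ S, f z ∈ T → ∀ y ∈ B, Solo G S f z y → #(nbr G B z) ≤ q := by
    intro z hz hzT y hy hzy
    have h := (hcon z hz hzT y (hmemB.1 hy).1 (hmemB.1 hy).2 hzy).1
    have h1 := card_nbr_add_card_le (G := G) (S := S) (f := f) (v := z) (erase_subset (f z) X)
      fun c hc => h c (mem_of_mem_erase hc) (ne_of_mem_erase hc)
    have h2 := card_erase_add_one (hTX hzT)
    have h3 := hdeg z hz
    rw [← hBdef] at h1
    omega
  have hlt : q < #T := by
    obtain ⟨W, hW⟩ := hT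
    refine lt_card_of_not_movable (hTX hW) (hcard W hW) hB hBX ?_ ?_
    · intro x hx
      obtain ⟨hxS, rfl⟩ := mem_filter.1 hx
      have h1 := card_nbr_add_card_le (G := G) (S := S) (f := f) (v := x)
        (D := (X \ T).erase U) (X := X) ((erase_subset _ _).trans sdiff_subset)
        fun c hc => by
          obtain ⟨hcU, hc⟩ := mem_erase.1 hc
          exact hTU x hxS hW c (mem_sdiff.1 hc).1 (mem_sdiff.1 hc).2 hcU
      have h2 := card_erase_add_one (mem_sdiff.2 ⟨hU, hUT⟩)
      have h3 := card_sdiff_add_card_eq_card hTX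
      have h4 := hdeg x hxS
      omega
    · intro z hz y hy hyX hzy
      obtain ⟨hzS, rfl⟩ := mem_filter.1 hz
      exact hsolo z hzS hW y (hmemB.2 ⟨hy, hyX⟩) hzy
  let A' : Finset V := {z ∈ S | f z ∈ T}
  have hA' : #A' = #T * s := by
    have hmaps : Set.MapsTo f A' T := fun z hz => (mem_filter.1 (mem_coe.1 hz)).2
    rw [card_eq_sum_card_fiberwise hmaps, ← smul_eq_mul, ← sum_const]
    refine sum_congr rfl fun c hc => ?_
    rw [← hcard c hc, filter_filter]
    congr 1
    ext v
    simp only [mem_filter]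
    constructor
    · rintro ⟨h1, _, h2⟩; exact ⟨h1, h2⟩
    · rintro ⟨h1, rfl⟩; exact ⟨h1, hc, rfl⟩
  let down : V → Finset V := fun z => {y ∈ B | Solo G S f z y}
  let up : V → Finset V := fun y => {z ∈ A' | Solo G S f z y}
  have hupper : ∑ z ∈ A', ∑ y ∈ down z, (q : ℚ) / #(down z) ≤ q * (#T * s) := by
    calc _ ≤ ∑ z ∈ A', (q : ℚ) := sum_le_sum fun z hz => ?_
      _ = q * (#T * s) := by rw [sum_const, hA', nsmul_eq_mul]; push_cast; ring
    rw [sum_const, nsmul_eq_mul, mul_div_left_comm]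
    exact mul_le_of_le_one_right (Nat.cast_nonneg q) (div_self_le_one _)
  have hlower : (#T : ℚ) * (q * s + 1) ≤ ∑ y ∈ B, ∑ z ∈ up y, (q : ℚ) / #(down z) := by
    calc (#T : ℚ) * (q * s + 1) = ∑ y ∈ B, (#T : ℚ) := by
          rw [sum_const, hB, nsmul_eq_mul]; push_cast; ring
      _ ≤ _ := sum_le_sum fun y hy => ?_
    obtain ⟨hyS, hyX⟩ := hmemB.1 hy
    have h3 := card_add_card_nbr_lt hq hTX (hdeg y hyS) (hBX y hyS hyX)
    have hup : #{z ∈ S | f z ∈ T ∧ Solo G S f z y} = #(up y) := by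
      simp only [up, A', filter_filter]
    rw [← hBdef, hup] at h3
    obtain ⟨z, hz, hmax⟩ := exists_max_image (up y) (fun z => #(down z)) (card_pos.1 (by omega))
    obtain ⟨hzA, hzy⟩ := mem_filter.1 hz
    obtain ⟨hzS, hzT⟩ := mem_filter.1 hzA
    have hydown : y ∈ down z := mem_filter.2 ⟨hy, hzy⟩
    have hcq : #(down z) ≤ q := by
      refine (card_le_card fun w hw => ?_).trans (hsolo z hzS hzT y hy hzy)
      obtain ⟨hwB, hzw⟩ := mem_filter.1 hw
      exact mem_filter.2 ⟨hwB, hzw.1.symm⟩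
    have hcd : #(down z) ≤ #(nbr G B y) + 1 := by
      rw [← card_erase_add_one hydown]
      gcongr
      intro w hw
      obtain ⟨hwy, hw⟩ := mem_erase.1 hw
      obtain ⟨hwB, hzw⟩ := mem_filter.1 hw
      exact mem_filter.2 ⟨hwB, (hcon z hzS hzT y hyS hyX hzy).2 w (hmemB.1 hwB).1
        (hmemB.1 hwB).2 hzw hwy⟩
    have hpos : 0 < #(down z) := card_pos.2 ⟨y, hydown⟩
    have hn : #T + #(down z) ≤ q + #(up y) := by omega
    have hterm : ∑ _w ∈ up y, (q : ℚ) / #(down z) ≤ ∑ w ∈ up y, (q : ℚ) / #(down w) := by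
      refine sum_le_sum fun w hw => ?_
      have hw' : 0 < #(down w) := card_pos.2 ⟨y, mem_filter.2 ⟨hy, (mem_filter.1 hw).2⟩⟩
      have := hmax w hw
      gcongr
    refine le_trans ?_ hterm
    rw [sum_const, nsmul_eq_mul, ← mul_div_assoc, le_div_iff₀ (by exact_mod_cast hpos)]
    have e1 : (#T : ℚ) + #(down z) ≤ q + #(up y) := by exact_mod_cast hn
    have e2 : (#(down z) : ℚ) ≤ q := by exact_mod_cast hcq
    have e3 : (q : ℚ) ≤ #T := by exact_mod_cast hlt.le
    have e4 : (0 : ℚ) ≤ q := Nat.cast_nonneg q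
    nlinarith [mul_nonneg (sub_nonneg.2 e3) (sub_nonneg.2 e2), mul_le_mul_of_nonneg_right e1 e4]
  have hswap : ∑ z ∈ A', ∑ y ∈ down z, (q : ℚ) / #(down z) =
      ∑ y ∈ B, ∑ z ∈ up y, (q : ℚ) / #(down z) := by
    refine sum_comm' fun z y => ?_
    simp only [down, up, mem_filter]
    tauto
  have hTpos : (0 : ℚ) < #T := by exact_mod_cast hT.card_pos
  rw [hswap] at hupper
  nlinarith

end Counting

/-! ### From nearly equitable to equitable colorings -/

/-- `G` restricted to `S` has a proper coloring by `C` with all classes of size `s`. -/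
def HasEquitable (G : SimpleGraph V) (S : Finset V) (C : Finset κ) (s : ℕ) : Prop :=
  ∃ g : V → κ, IsCol G S C g ∧ ∀ c ∈ C, #(cls S g c) = s

/-- All classes of `f` have size `s`, except that `a` lacks one vertex and `b` has one too many. -/
def NearlyEquitable (S : Finset V) (C : Finset κ) (s : ℕ) (f : V → κ) (a b : κ) : Prop :=
  ∀ c ∈ C, #(cls S f c) + (if a = c then 1 else 0) = s + if b = c then 1 else 0

/-- The colors from which `a` can be reached by successive moves. -/
noncomputable def accessible (G : SimpleGraph V) (S : Finset V) (C : Finset κ) (f : V → κ)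
    (a : κ) : Finset κ :=
  {c ∈ C | PathIn (Movable G S f) a C c}

lemma accessible_subset : accessible G S C f a ⊆ C := filter_subset _ _

lemma pathIn_accessible (hc : c ∈ accessible G S C f a) :
    PathIn (Movable G S f) a (accessible G S C f a) c :=
  (mem_filter.1 hc).2.restrict fun _ hy => mem_filter.2 ⟨hy.left_mem, hy⟩

lemma not_free_of_notMem_accessible (hf : IsCol G S C f) (hv : v ∈ S)
    (hvA : f v ∉ accessible G S C f a) (hc : c ∈ accessible G S C f a) : ¬ Free G S f v c :=
  fun h => hvA (mem_filter.2 ⟨hf.mem v hv,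
    (mem_filter.1 hc).2.cons (hf.mem v hv) ⟨v, hv, rfl, h⟩⟩)

lemma card_outside (hf : IsCol G S C f) (hs : NearlyEquitable S C s f a b) {X : Finset κ}
    (ha : a ∈ X) (hb : b ∈ C) (hbX : b ∉ X) :
    #{v ∈ S | f v ∉ X} = #(C \ X) * s + 1 := by
  have hmaps : Set.MapsTo f ({v ∈ S | f v ∉ X} : Finset V) (C \ X : Finset κ) := fun v hv => by
    obtain ⟨h1, h2⟩ := mem_filter.1 (mem_coe.1 hv)
    exact mem_coe.2 (mem_sdiff.2 ⟨hf.mem v h1, h2⟩)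
  rw [card_eq_sum_card_fiberwise hmaps]
  have hsum : ∀ c ∈ C \ X, #{v ∈ ({v ∈ S | f v ∉ X} : Finset V) | f v = c} =
      s + if b = c then 1 else 0 := by
    intro c hc
    obtain ⟨hcC, hcX⟩ := mem_sdiff.1 hc
    have h1 := hs c hcC
    rw [if_neg (ne_of_mem_of_not_mem ha hcX), add_zero] at h1
    rw [← h1, filter_filter]
    congr 1
    ext v
    simp only [mem_filter]
    constructor
    · rintro ⟨hv, _, hvc⟩; exact ⟨hv, hvc⟩
    · rintro ⟨hv, rfl⟩; exact ⟨hv, hcX, rfl⟩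
  rw [sum_congr rfl hsum, sum_add_distrib, sum_const, smul_eq_mul, sum_ite_eq,
    if_pos (mem_sdiff.2 ⟨hb, hbX⟩)]

lemma one_lt_card_accessible (hf : IsCol G S C f) (hdeg : ∀ v ∈ S, #(nbr G S v) < #C)
    (hs : NearlyEquitable S C s f a b) (hab : a ≠ b) (ha : a ∈ C) (hb : b ∈ C)
    (hbA : b ∉ accessible G S C f a) : 1 < #(accessible G S C f a) := by
  have haA : a ∈ accessible G S C f a := mem_filter.2 ⟨ha, .refl ha⟩
  have hB := card_outside hf hs haA hb hbA
  have hq := card_sdiff_add_card_eq_card (accessible_subset (G := G) (S := S) (C := C) (f := f)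
    (a := a))
  by_contra! hle
  set X := accessible G S C f a with hX
  set B : Finset V := {v ∈ S | f v ∉ X}
  have h1 : #B ≤ ∑ y ∈ B, #(nbr G (cls S f a) y) := by
    rw [card_eq_sum_ones]
    refine sum_le_sum fun y hy => card_nbr_cls_pos ?_
    exact not_free_of_notMem_accessible hf (mem_filter.1 hy).1 (mem_filter.1 hy).2 haA
  have h2 : ∑ x ∈ cls S f a, #(nbr G B x) ≤ #(cls S f a) * #(C \ X) := by
    rw [← smul_eq_mul, ← sum_const]
    refine sum_le_sum fun x hx => ?_
    have h3 := hdeg x (mem_filter.1 hx).1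
    have h4 : #(nbr G B x) ≤ #(nbr G S x) :=
      card_le_card (filter_subset_filter _ (filter_subset _ _))
    omega
  rw [sum_card_nbr_comm] at h1
  have h5 := hs a ha
  rw [if_pos rfl, if_neg hab.symm] at h5
  nlinarith

/-- Removing a vertex `y` outside the accessible classes leaves a graph outside the accessible
classes to which induction applies. -/
lemma hasEquitable_outside (hf : IsCol G S C f) (hdeg : ∀ v ∈ S, #(nbr G S v) < #C)
    (ih : ∀ (S' : Finset V) (C' : Finset κ), #S' < #S → #S' = #C' * s →
      (∀ v ∈ S', #(nbr G S' v) < #C') → HasEquitable G S' C' s)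
    (hs : NearlyEquitable S C s f a b) (ha : a ∈ C) (hb : b ∈ C)
    (hbA : b ∉ accessible G S C f a) {y : V} (hy : y ∈ S) (hyA : f y ∉ accessible G S C f a) :
    HasEquitable G (({v ∈ S | f v ∉ accessible G S C f a} : Finset V).erase y)
      (C \ accessible G S C f a) s := by
  have haA : a ∈ accessible G S C f a := mem_filter.2 ⟨ha, .refl ha⟩
  have hB := card_outside hf hs haA hb hbA
  have hq := card_sdiff_add_card_eq_card (accessible_subset (G := G) (S := S) (C := C) (f := f)
    (a := a))
  have hyB : y ∈ ({v ∈ S | f v ∉ accessible G S C f a} : Finset V) := mem_filter.2 ⟨hy, hyA⟩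
  have hcard := card_erase_add_one hyB
  have hBS := card_le_card (filter_subset (fun v => f v ∉ accessible G S C f a) S)
  refine ih _ _ (by omega) (by omega) fun v hv => ?_
  obtain ⟨hvS, hvA⟩ := mem_filter.1 (mem_of_mem_erase hv)
  have h1 := card_nbr_add_card_le Subset.rfl
    fun c hc => not_free_of_notMem_accessible (c := c) hf hvS hvA hc
  have h2 := hdeg v hvS
  have h3 : #(nbr G (({v ∈ S | f v ∉ accessible G S C f a} : Finset V).erase y) v) ≤
      #(nbr G {v ∈ S | f v ∉ accessible G S C f a} v) :=
    card_le_card (filter_subset_filter _ (erase_subset _ _))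
  omega

lemma hasEquitable_of_nearlyEquitable (hdeg : ∀ v ∈ S, #(nbr G S v) < #C)
    (ih : ∀ (S' : Finset V) (C' : Finset κ), #S' < #S → #S' = #C' * s →
      (∀ v ∈ S', #(nbr G S' v) < #C') → HasEquitable G S' C' s)
    (hf : IsCol G S C f) (ha : a ∈ C) (hb : b ∈ C) (hab : a ≠ b)
    (hs : NearlyEquitable S C s f a b) : HasEquitable G S C s := by
  induction hn : #(C \ accessible G S C f a) using Nat.strong_induction_on generalizing f b with
  | _ n ihn =>
  subst hn
  have haA : a ∈ accessible G S C f a := mem_filter.2 ⟨ha, .refl ha⟩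
  by_cases hbA : b ∈ accessible G S C f a
  · obtain ⟨g, hg, hcard⟩ := exists_shift Subset.rfl (mem_filter.1 hbA).2 hf
    refine ⟨g, hg, fun c hc => ?_⟩
    have h1 := hcard c
    have h2 := hs c hc
    omega
  have hXC : accessible G S C f a ⊆ C := accessible_subset
  have hX : ∀ c ∈ accessible G S C f a,
    PathIn (Movable G S f) a (accessible G S C f a) c := fun c => pathIn_accessible
  have hone := one_lt_card_accessible hf hdeg hs hab ha hb hbA
  have hB := card_outside hf hs haA hb hbA
  have hBX : ∀ y ∈ S, f y ∉ accessible G S C f a → ∀ c ∈ accessible G S C f a,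
    ¬ Free G S f y c := fun y hy hyA c hc => not_free_of_notMem_accessible hf hy hyA hc
  have hout := fun y => hasEquitable_outside (y := y) hf hdeg ih hs ha hb hbA
  have hq := card_sdiff_add_card_eq_card hXC
  set X := accessible G S C f a with hXdef
  obtain ⟨U, hU, T, hTX, hUT, hT, hterm, hTU⟩ := exists_terminal_set hX haA hone
  have hTa : ∀ W ∈ T, W ≠ a := by
    rintro W hW rfl
    exact notMem_erase W X
      (hterm W hW U (mem_erase.2 ⟨fun h => hUT (h ▸ hW), hU⟩)).right_mem
  have hTcard : ∀ c ∈ T, #(cls S f c) = s := by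
    intro c hc
    have := hs c (hXC (hTX hc))
    rwa [if_neg (hTa c hc).symm, if_neg (ne_of_mem_of_not_mem (hTX hc) hbA).symm] at this
  obtain ⟨z, hz, hzT, y, hy, hyX, hzy, hcase⟩ := exists_solo hdeg (by omega) hTX hT hU hUT hTcard
    hB hBX fun x hx hxT c hc hcT hcU h => hTU _ hxT c hc hcT hcU ⟨x, hx, rfl, h⟩
  have hzX := hTX hzT
  have hzy_ne : z ≠ y := hzy.1.ne'
  obtain ⟨g, hg, hgcard⟩ := hout y hy hyX
  set A : Finset V := {v ∈ S | f v ∈ X} with hA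
  set B : Finset V := {v ∈ S | f v ∉ X} with hBdef
  have hzA : z ∈ A := mem_filter.2 ⟨hz, hzX⟩
  have hyA : y ∉ A := fun h => hyX (mem_filter.1 h).2
  have hyB : y ∈ B := mem_filter.2 ⟨hy, hyX⟩
  have hzB : z ∉ B := fun h => (mem_filter.1 h).2 hzX
  have hAB : A ∪ B = S := filter_union_filter_not_eq _ _
  have hABd : Disjoint A B := disjoint_filter_filter_not _ _ _
  have hfA : IsCol G A X f :=
    ⟨fun v hv => (mem_filter.1 hv).2, (hf.subset (filter_subset _ _)).proper⟩
  have hclsA : ∀ c ∈ X, cls A f c = cls S f c := by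
    intro c hc
    ext v
    simp only [cls, A, mem_filter]
    constructor
    · rintro ⟨⟨h1, _⟩, h2⟩; exact ⟨h1, h2⟩
    · rintro ⟨h1, rfl⟩; exact ⟨⟨h1, hc⟩, rfl⟩
  have hXd : Disjoint X (C \ X) := disjoint_sdiff
  have hXU : X ∪ (C \ X) = C := union_sdiff_of_subset hXC
  by_cases hmov : ∃ c ∈ X, c ≠ f z ∧ Free G S f z c
  · obtain ⟨d, hd, hdz, hfree⟩ := hmov
    have hf1 : IsCol G A X (Function.update f z d) :=
      hfA.update hd hzA fun w hw => hfree w (mem_filter.1 hw).1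
    have hyfree : Free G A (Function.update f z d) y (f z) := by
      intro w hw hwz hyw
      by_cases hwz' : w = z
      · subst hwz'
        exact hdz (by simpa using hwz)
      · rw [Function.update_of_ne hwz'] at hwz
        exact hwz' (hzy.2 w (mem_filter.1 hw).1 hwz hyw)
    have hf2 := hf1.insert hzX hyA hyfree
    have hpath : PathIn (Movable G (insert y A)
        (Function.update (Function.update f z d) y (f z))) a (X.erase (f z)) d := by
      refine (hterm (f z) hzT d (mem_erase.2 ⟨hdz, hd⟩)).mono_rel_of_ne ?_
      rintro p hp c hc hcd ⟨v, hv, rfl, hvc⟩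
      have hvz : v ≠ z := by rintro rfl; exact ne_of_mem_erase hp rfl
      have hvA : v ∈ A := mem_filter.2 ⟨hv, mem_of_mem_erase hp⟩
      refine ⟨v, mem_insert_of_mem hvA, ?_, fun w hw hwc => ?_⟩
      · rw [Function.update_of_ne (ne_of_mem_of_not_mem hvA hyA), Function.update_of_ne hvz]
      · by_cases hwy : w = y
        · subst hwy
          exact absurd (by simpa using hwc.symm) (ne_of_mem_erase hc)
        rw [Function.update_of_ne hwy] at hwc
        by_cases hwz : w = z
        · subst hwz
          exact absurd (by simpa using hwc.symm) hcd
        rw [Function.update_of_ne hwz] at hwc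
        exact hvc w (mem_filter.1 ((mem_insert.1 hw).resolve_left hwy)).1 hwc
    obtain ⟨f', hf', hcard'⟩ := exists_shift (erase_subset _ _) hpath hf2
    have hdisj : Disjoint (insert y A) (B.erase y) :=
      disjoint_insert_left.2 ⟨notMem_erase _ _, hABd.mono_right (erase_subset _ _)⟩
    obtain ⟨h, hh, -, -, h1, h2⟩ := hf'.union hg hXd hdisj
    have hSU : insert y A ∪ B.erase y = S := by
      rw [insert_union, ← union_insert, insert_erase hyB, hAB]
    rw [hXU, hSU] at hh
    refine ⟨h, hh, fun c hc => ?_⟩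
    rw [hSU] at h1 h2
    by_cases hcX : c ∈ X
    · rw [h1 c hcX]
      have e1 := hcard' c
      have e2 := card_cls_insert hyA (Function.update f z d) (f z) c
      have e3 := card_cls_update hzA f d c
      have e4 := hs c hc
      rw [hclsA c hcX] at e3
      rw [if_neg (ne_of_mem_of_not_mem hcX hbA).symm] at e4
      omega
    · have hc' := mem_sdiff.2 ⟨hc, hcX⟩
      rw [h2 c hc', hgcard c hc']
  · push Not at hmov
    obtain ⟨y', hy', hy'X, hzy', hy'y, hnadj⟩ := hcase.resolve_left fun ⟨c, h1, h2, h3⟩ =>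
      hmov c h1 h2 h3
    have hdegz : #(nbr G (B.erase y) z) < #(C \ X) := by
      have h1 := card_nbr_add_card_le (G := G) (S := S) (f := f) (v := z) (erase_subset (f z) X)
        fun c hc => hmov c (mem_of_mem_erase hc) (ne_of_mem_erase hc)
      have h2 := card_erase_add_one hzX
      have h3 := hdeg z hz
      have h4 : y ∈ nbr G B z := mem_filter.2 ⟨hyB, hzy.1.symm⟩
      have h5 := card_erase_add_one h4
      have h6 : nbr G (B.erase y) z = (nbr G B z).erase y := filter_erase _ _ _
      rw [← hBdef] at h1
      rw [h6]
      omega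
    obtain ⟨Y, hY, hYfree⟩ := exists_free (f := g) hdegz
    have hzB' : z ∉ B.erase y := fun h => hzB (mem_of_mem_erase h)
    have hyA' : y ∉ A.erase z := fun h => hyA (mem_of_mem_erase h)
    have hg1 := hg.insert hY hzB' hYfree
    have hf1 := (hfA.subset (erase_subset z A)).insert hzX hyA' fun w hw hwz hyw =>
      ne_of_mem_erase hw (hzy.2 w (mem_filter.1 (mem_of_mem_erase hw)).1 hwz hyw)
    have hdisj : Disjoint (insert y (A.erase z)) (insert z (B.erase y)) := by
      refine disjoint_insert_left.2 ⟨?_, disjoint_insert_right.2 ⟨notMem_erase _ _, ?_⟩⟩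
      · simp [hzy_ne.symm]
      · exact hABd.mono (erase_subset _ _) (erase_subset _ _)
    obtain ⟨h, hh, hhf, hhg, h1, h2⟩ := hf1.union hg1 hXd hdisj
    have hSU : insert y (A.erase z) ∪ insert z (B.erase y) = S := by
      rw [insert_union, union_insert, insert_comm, ← union_insert, insert_erase hyB,
        ← insert_union, insert_erase hzA, hAB]
    rw [hSU] at hh h1 h2
    rw [hXU] at hh
    have hYC := (mem_sdiff.1 hY).1
    have hYX := (mem_sdiff.1 hY).2
    have hnear : NearlyEquitable S C s h a Y := by
      intro c hc
      by_cases hcX : c ∈ X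
      · rw [h1 c hcX, card_cls_insert hyA' f (f z) c, card_cls_erase hzA f c, hclsA c hcX, hs c hc,
          if_neg (ne_of_mem_of_not_mem hcX hbA).symm, if_neg (ne_of_mem_of_not_mem hcX hYX).symm]
      · have hc' := mem_sdiff.2 ⟨hc, hcX⟩
        rw [h2 c hc', card_cls_insert hzB' g Y c, hgcard c hc',
          if_neg (ne_of_mem_of_not_mem haA hcX), add_zero]
    have hcls : ∀ c ∈ X, c ≠ f z → ∀ v, v ∈ S ∧ h v = c ↔ v ∈ S ∧ f v = c := by
      intro c hc hcz v
      have hcard : cls S h c = cls S f c := by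
        rw [h1 c hc, ← hclsA c hc]
        ext w
        simp only [cls, mem_filter, mem_insert, mem_erase]
        constructor
        · rintro ⟨rfl | ⟨_, hw⟩, e⟩
          · exact absurd (by simpa using e.symm) hcz
          · exact ⟨hw, by rwa [Function.update_of_ne (ne_of_mem_of_not_mem hw hyA)] at e⟩
        · rintro ⟨hw, e⟩
          refine ⟨.inr ⟨?_, hw⟩, ?_⟩
          · rintro rfl; exact hcz e.symm
          · rwa [Function.update_of_ne (ne_of_mem_of_not_mem hw hyA)]
      have := congrArg (v ∈ ·) hcard
      simpa only [cls, mem_filter, eq_iff_iff] using this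
    have hmove : ∀ p ∈ X.erase (f z), ∀ c ∈ X.erase (f z), Movable G S f p c →
        Movable G S h p c := by
      rintro p hp c hc ⟨v, hv, hvp, hvc⟩
      obtain ⟨hpz, hp⟩ := mem_erase.1 hp
      obtain ⟨hcz, hc⟩ := mem_erase.1 hc
      obtain ⟨hv', hvp'⟩ := (hcls p hp hpz v).2 ⟨hv, hvp⟩
      refine ⟨v, hv', hvp', fun w hw hwc => ?_⟩
      obtain ⟨hw', hwc'⟩ := (hcls c hc hcz w).1 ⟨hw, hwc⟩
      exact hvc w hw' hwc'
    have hpath : ∀ c ∈ X, PathIn (Movable G S h) a X c := by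
      intro c hc
      by_cases hcz : c = f z
      · subst hcz
        generalize hW : f z = W at *
        cases hX W hc with
        | refl => exact absurd rfl (hTa _ hzT)
        | @step _ _ d _ hd hpath =>
          refine .step hc ?_ (hpath.mono_rel hmove)
          obtain ⟨w, hw, hwW, hwd⟩ := hd
          obtain ⟨hdW, hdX⟩ := mem_erase.1 hpath.left_mem
          have hwz : w ≠ z := by
            rintro rfl
            exact hmov d hdX hdW hwd
          have hwA : w ∈ A := mem_filter.2 ⟨hw, hwW ▸ hc⟩
          refine ⟨w, hw, ?_, fun u hu hud => ?_⟩
          · rw [hhf w (mem_insert_of_mem (mem_erase.2 ⟨hwz, hwA⟩)),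
              Function.update_of_ne (ne_of_mem_of_not_mem hwA hyA), hwW]
          · obtain ⟨hu', hud'⟩ := (hcls d hdX hdW u).1 ⟨hu, hud⟩
            exact hwd u hu' hud'
      · exact ((hterm (f z) hzT c (mem_erase.2 ⟨hcz, hc⟩)).mono_rel hmove).mono_set
          (erase_subset _ _)
    have hy'move : Movable G S h (h y') (f z) := by
      refine ⟨y', hy', rfl, fun w hw hwz hadj => ?_⟩
      have hwmem : w ∈ cls S h (f z) := mem_filter.2 ⟨hw, hwz⟩
      rw [h1 _ hzX] at hwmem
      obtain ⟨hw1, hw2⟩ := mem_filter.1 hwmem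
      rcases mem_insert.1 hw1 with rfl | hw1
      · exact hnadj hadj.symm
      · obtain ⟨hwne, hwA⟩ := mem_erase.1 hw1
        rw [Function.update_of_ne (ne_of_mem_of_not_mem hwA hyA)] at hw2
        exact hwne (hzy'.2 w hw hw2 hadj)
    have hy'mem : y' ∈ insert z (B.erase y) :=
      mem_insert_of_mem (mem_erase.2 ⟨hy'y, mem_filter.2 ⟨hy', hy'X⟩⟩)
    have hy'col : h y' ∈ C \ X := hhg y' hy'mem ▸ hg1.mem y' hy'mem
    refine ihn _ ?_ hh hYC (ne_of_mem_of_not_mem haA hYX) hnear rfl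
    refine card_lt_card ⟨fun c hc => ?_, fun hsub => ?_⟩
    · obtain ⟨hcC, hc⟩ := mem_sdiff.1 hc
      exact mem_sdiff.2 ⟨hcC, fun hcX => hc (mem_filter.2 ⟨hcC, (hpath c hcX).mono_set hXC⟩)⟩
    · refine (mem_sdiff.1 (hsub hy'col)).2 (mem_filter.2 ⟨(mem_sdiff.1 hy'col).1, ?_⟩)
      exact ((hpath _ hzX).mono_set hXC).cons (mem_sdiff.1 hy'col).1 hy'move

/-! ### Equitable colorings with classes of equal size -/

lemma hasEquitable_bot [Nonempty κ] (hS : #S = #C * s) :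
    HasEquitable (⊥ : SimpleGraph V) S C s := by
  induction C using Finset.induction_on generalizing S with
  | empty =>
    obtain rfl : S = ∅ := by simpa using hS
    exact ⟨fun _ => Classical.arbitrary κ, ⟨by simp, by simp⟩, by simp⟩
  | insert c C hc ih =>
    rw [card_insert_of_notMem hc, add_mul, one_mul] at hS
    obtain ⟨S₀, hS₀, hcard⟩ := exists_subset_card_eq (show s ≤ #S by omega)
    have hsdiff := card_sdiff_add_card_eq_card hS₀
    obtain ⟨g, hg, hgcard⟩ := ih (S := S \ S₀) (by omega)
    have hconst : IsCol (⊥ : SimpleGraph V) S₀ {c} fun _ => c := ⟨by simp, by simp⟩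
    obtain ⟨h, hh, -, -, h1, h2⟩ := hconst.union hg (disjoint_singleton_left.2 hc) disjoint_sdiff
    rw [union_sdiff_of_subset hS₀] at hh h1 h2
    refine ⟨h, by rwa [insert_eq], fun d hd => ?_⟩
    rcases mem_insert.1 hd with rfl | hd
    · rw [h1 d (mem_singleton_self d), cls, filter_true_of_mem fun _ _ => rfl, hcard]
    · rw [h2 d hd, hgcard d hd]

/-- The edges of `G` with both ends in `T`. -/
def edgesWithin (G : SimpleGraph V) (T : Finset V) : SimpleGraph V where
  Adj u v := G.Adj u v ∧ u ∈ T ∧ v ∈ T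
  symm := ⟨fun _ _ h => ⟨h.1.symm, h.2.2, h.2.1⟩⟩
  loopless := ⟨fun _ h => h.1.ne rfl⟩

theorem hasEquitable_of_card_eq [Nonempty κ] (hS : #S = #C * s)
    (hdeg : ∀ v ∈ S, #(nbr G S v) < #C) : HasEquitable G S C s := by
  induction hn : #S using Nat.strong_induction_on generalizing G S C with
  | _ n ih =>
  subst hn
  have key : ∀ T : Finset V, HasEquitable (edgesWithin G T) S C s := by
    intro T
    induction T using Finset.induction_on with
    | empty =>
      obtain ⟨f, hf, hcard⟩ := hasEquitable_bot hS
      exact ⟨f, ⟨hf.mem, fun _ _ _ _ h => absurd h.2.1 (notMem_empty _)⟩, hcard⟩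
    | insert u T _ ihT =>
      obtain ⟨f, hf, hcard⟩ := ihT
      have hf' : IsCol (edgesWithin G (insert u T)) (S.erase u) C f := by
        refine ⟨fun v hv => hf.mem v (mem_of_mem_erase hv), fun v hv w hw hvw => ?_⟩
        obtain ⟨hvu, hvS⟩ := mem_erase.1 hv
        obtain ⟨hwu, hwS⟩ := mem_erase.1 hw
        exact hf.proper v hvS w hwS ⟨hvw.1, (mem_insert.1 hvw.2.1).resolve_left hvu,
          (mem_insert.1 hvw.2.2).resolve_left hwu⟩
      by_cases hu : u ∈ S
      swap
      · exact ⟨f, by rwa [erase_eq_of_notMem hu] at hf', hcard⟩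
      have hdeg' : ∀ v ∈ S, #(nbr (edgesWithin G (insert u T)) S v) < #C := fun v hv =>
        (card_le_card (monotone_filter_right S fun _ _ h => h.1)).trans_lt (hdeg v hv)
      obtain ⟨Y, hY, hfree⟩ := exists_free (f := f) (hdeg' u hu)
      have hg := hf'.insert hY (notMem_erase u S) fun w hw => hfree w (mem_of_mem_erase hw)
      rw [insert_erase hu] at hg
      have hsize := card_cls_update hu f Y
      by_cases hYu : f u = Y
      · refine ⟨_, hg, fun c hc => ?_⟩
        have := hsize c
        rw [hYu, hcard c hc] at this
        omega
      · refine hasEquitable_of_nearlyEquitable hdeg' (fun S' C' hlt hS' hd => ?_) hg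
          (hf.mem u hu) hY hYu fun c hc => by rw [hsize c, hcard c hc]
        exact ih _ hlt hS' hd rfl
  obtain ⟨f, hf, hcard⟩ := key S
  exact ⟨f, ⟨hf.mem, fun u hu v hv huv => hf.proper u hu v hv ⟨huv, hu, hv⟩⟩, hcard⟩

end

end HajnalSzemeredi

open HajnalSzemeredi in
/-- **Hajnal–Szemerédi Theorem.** Every graph `G` with maximum degree `Δ(G) < k` has an
equitable `k`-coloring: a proper coloring with `k` colors in which the sizes of any two
color classes differ by at most 1. -/
theorem hajnal_szemeredi {V : Type*} [Fintype V] (G : SimpleGraph V) [DecidableRel G.Adj]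
    (k : ℕ) (hk : G.maxDegree < k) :
    ∃ f : V → Fin k,
      (∀ ⦃u v : V⦄, G.Adj u v → f u ≠ f v) ∧
      (∀ c c' : Fin k,
        (Finset.univ.filter fun v => f v = c).card ≤
          (Finset.univ.filter fun v => f v = c').card + 1) := by
  classical
  have hk0 : 0 < k := Nat.zero_lt_of_lt hk
  have : Nonempty (Fin k) := ⟨⟨0, hk0⟩⟩
  -- Add a clique on `p ≤ k` new vertices to make the number of vertices divisible by `k`.
  obtain ⟨p, s, hp, hps⟩ : ∃ p s, p ≤ k ∧ Fintype.card V + p = k * s :=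
    ⟨k - Fintype.card V % k, Fintype.card V / k + 1, Nat.sub_le _ _, by
      have h1 := Nat.div_add_mod (Fintype.card V) k
      have h2 := Nat.mod_lt (Fintype.card V) hk0
      rw [Nat.mul_add]
      omega⟩
  let H : SimpleGraph (V ⊕ Fin p) := G ⊕g ⊤
  have hdeg : ∀ x ∈ (Finset.univ : Finset (V ⊕ Fin p)),
      (nbr H Finset.univ x).card < (Finset.univ : Finset (Fin k)).card := by
    rintro (v | i) -
    · have hsub : nbr H Finset.univ (Sum.inl v) ⊆ (G.neighborFinset v).image Sum.inl := by
        rintro (w | j) hw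
        · simpa [H] using hw
        · simp [H] at hw
      have h1 := (Finset.card_le_card hsub).trans Finset.card_image_le
      have h2 := G.degree_le_maxDegree v
      rw [G.card_neighborFinset_eq_degree] at h1
      rw [Finset.card_fin]
      omega
    · have hsub : nbr H Finset.univ (Sum.inr i) ⊆ (Finset.univ.erase i).image Sum.inr := by
        rintro (w | j) hw
        · simp [H] at hw
        · simpa [H, eq_comm] using hw
      have h1 := (Finset.card_le_card hsub).trans Finset.card_image_le
      have h2 := Finset.card_erase_add_one (Finset.mem_univ i)
      rw [Finset.card_fin] at h2 ⊢
      omega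
  obtain ⟨f, hf, hcard⟩ := hasEquitable_of_card_eq (G := H) (C := (Finset.univ : Finset (Fin k)))
    (s := s) (by simpa using hps) hdeg
  have hsum : ∀ c, (Finset.univ.filter fun v => f (Sum.inl v) = c).card +
      (Finset.univ.filter fun i => f (Sum.inr i) = c).card = s := by
    intro c
    rw [← hcard c (Finset.mem_univ c), ← Finset.card_disjSum]
    congr 1
    ext (v | i) <;> simp
  have hle : ∀ c, (Finset.univ.filter fun i => f (Sum.inr i) = c).card ≤ 1 := by
    intro c
    refine Finset.card_le_one.2 fun i hi j hj => ?_
    by_contra hij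
    refine hf.proper (Sum.inr i) (Finset.mem_univ _) (Sum.inr j) (Finset.mem_univ _)
      (by simpa [H] using hij) ?_
    rw [(Finset.mem_filter.1 hi).2, (Finset.mem_filter.1 hj).2]
  refine ⟨fun v => f (Sum.inl v), fun u v huv => ?_, fun c c' => ?_⟩
  · exact hf.proper _ (Finset.mem_univ _) _ (Finset.mem_univ _) (by simpa [H] using huv)
  · have h1 := hsum c
    have h2 := hsum c'
    have h3 := hle c'
    beta_reduce
    omega
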